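/- Let q be a prime power and n, k positive integers with k | n. Let γ ∈ F_{q^n}^* be a root of an irreducible polynomial of degree n/k over F_{q^k}, where n/k > 2. Then U = {u + u^q γ : u ∈ F_{q^k}} is a Sidon space of F_q-dimension k. -/

import Mathlib

open Submodule Pointwise

set_option maxHeartbeats 1000000
set_option synthInstance.maxHeartbeats 400000

/-- An `F`-subspace `V` of a field `K` is a *Sidon space* if for all nonzero
`a, b, c, d ∈ V` with `a * b = c * d` one has `{aF, bF} = {cF, dF}` (as a pair of
one-dimensional `F`-subspaces). -/
def IsSidonSpace {K : Type*} [Field K] (F : Subfield K) (V : Submodule F K) : Prop :=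
  ∀ a ∈ V, ∀ b ∈ V, ∀ c ∈ V, ∀ d ∈ V,
    a ≠ 0 → b ≠ 0 → c ≠ 0 → d ≠ 0 → a * b = c * d →
    ({Submodule.span F {a}, Submodule.span F {b}} : Set (Submodule F K)) =
      {Submodule.span F {c}, Submodule.span F {d}}

/-- In a field `K`, a finite subfield of order `q` contains every fixed point of `x ↦ x ^ q`. -/
theorem Subfield.mem_of_pow_natCard_eq {K : Type*} [Field K] (F : Subfield K) [Finite F] {x : K}
    (hx : x ^ Nat.card F = x) : x ∈ F := by
  have := Fintype.ofFinite F
  rw [Nat.card_eq_fintype_card] at hx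
  let p : Polynomial F := .X ^ Fintype.card F - .X
  have hp : p ≠ 0 := FiniteField.X_pow_card_sub_X_ne_zero F Fintype.one_lt_card
  have hsplits : p.Splits := by
    rw [Polynomial.splits_iff_card_roots, FiniteField.roots_X_pow_card_sub_X, ← Finset.card_def,
      Finset.card_univ, FiniteField.X_pow_card_sub_X_natDegree_eq F Fintype.one_lt_card]
  have hroot : x ∈ (p.map F.subtype).roots := by
    rw [Polynomial.mem_roots (Polynomial.map_ne_zero hp)]
    simp [p, hx]
  rw [hsplits.roots_map] at hroot
  obtain ⟨a, -, rfl⟩ := Multiset.mem_map.1 hroot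
  exact a.2

/-- Powers `1, γ, γ ^ 2` are linearly independent over `L` if `γ` has degree more than `2`. -/
theorem eq_zero_of_quadratic_eq_zero {K : Type*} [Field K] (L : Subfield K) {γ : K}
    (h : 2 < (minpoly L γ).natDegree) {a b c : K} (ha : a ∈ L) (hb : b ∈ L) (hc : c ∈ L)
    (h0 : c * γ ^ 2 + b * γ + a = 0) : a = 0 ∧ b = 0 ∧ c = 0 := by
  let p : Polynomial L := .C ⟨c, hc⟩ * .X ^ 2 + .C ⟨b, hb⟩ * .X + .C ⟨a, ha⟩
  have hp : p = 0 := by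
    by_contra hp
    have hdvd : minpoly L γ ∣ p := minpoly.dvd _ _ (by
      simp only [p, map_add, map_mul, map_pow, Polynomial.aeval_X, Polynomial.aeval_C]
      exact h0)
    have h1 := Polynomial.natDegree_le_of_dvd hdvd hp
    have h2 : p.natDegree ≤ 2 := Polynomial.natDegree_quadratic_le
    omega
  have e0 := congrArg (Polynomial.coeff · 0) hp
  have e1 := congrArg (Polynomial.coeff · 1) hp
  have e2 := congrArg (Polynomial.coeff · 2) hp
  simp [p, Polynomial.coeff_X, Polynomial.coeff_C] at e0 e1 e2
  exact ⟨congrArg Subtype.val e0, congrArg Subtype.val e1, congrArg Subtype.val e2⟩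

/-- Over a finite subfield of order `q`, the map `u ↦ u + u ^ q * γ` is linear. -/
theorem exists_linearMap_add_pow_mul {K : Type*} [Field K] (F : Subfield K) [Finite F] (γ : K) :
    ∃ φ : K →ₗ[F] K, ∀ u, φ u = u + u ^ Nat.card F * γ := by
  have := Fintype.ofFinite F
  refine ⟨LinearMap.id + LinearMap.mulRight F γ ∘ₗ
    (FiniteField.frobeniusAlgHom F K).toLinearMap, fun u => ?_⟩
  simp [Nat.card_eq_fintype_card]

/-- A nonzero scalar multiple spans the same line. -/
theorem span_singleton_eq_of_mul_mem {K : Type*} [Field K] (F : Subfield K) {r x y : K}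
    (hr : r ∈ F) (hr0 : r ≠ 0) (h : x = r * y) : span F {x} = span F {y} := by
  have h' : x = (⟨r, hr⟩ : F) • y := h
  rw [h']
  exact span_singleton_smul_eq (IsUnit.mk0 _ fun h => hr0 (congrArg Subtype.val h)) y

/-- Solutions of the symmetric equations arising from comparing coefficients in a product of two
elements `u + u ^ q * γ`. -/
theorem exists_ratio_of_mul_eq {K : Type*} [Field K] {q : ℕ} {u v s t : K}
    (hv : v ≠ 0) (hs : s ≠ 0) (hmul : u * v = s * t)
    (hadd : u * v ^ q + u ^ q * v = s * t ^ q + s ^ q * t) :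
    (∃ r, r ^ q = r ∧ u = r * s ∧ t = r * v) ∨ ∃ r, r ^ q = r ∧ u = r * t ∧ s = r * v := by
  obtain ⟨r, rfl⟩ : ∃ r, u = r * s := ⟨u / s, by field_simp⟩
  obtain rfl : t = r * v := mul_left_cancel₀ hs (by rw [← hmul]; ring)
  have h : (r - r ^ q) * (s * v ^ q - s ^ q * v) = 0 := by
    simp only [mul_pow] at hadd
    linear_combination hadd
  rcases mul_eq_zero.1 h with h | h
  · exact .inl ⟨r, (sub_eq_zero.1 h).symm, rfl, rfl⟩
  · refine .inr ⟨s / v, ?_, by field_simp, by field_simp⟩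
    rw [div_pow, div_eq_div_iff (pow_ne_zero _ hv) hv]
    exact (sub_eq_zero.1 h).symm

/-- For `k ∣ n` and `γ` a root of an irreducible polynomial of degree
`n/k > 2` over `F_{q^k}`, the set `U = {u + uᑫγ : u ∈ F_{q^k}}` is a Sidon space of
dimension `k`. -/
theorem sidonSpace_u_uq {K : Type*} [Field K] (q n k : ℕ)
    (hq : IsPrimePow q) (hn : 0 < n) (hk : 0 < k) (hkn : k ∣ n)
    (hK : Nat.card K = q ^ n)
    (F : Subfield K) (hF : Nat.card F = q)
    (Fk : Subfield K) (hFk : Nat.card Fk = q ^ k) (hFFk : F ≤ Fk)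
    (γ : K) (hγ : γ ≠ 0)
    (hdeg : (minpoly Fk γ).natDegree = n / k) (hdeg2 : 2 < n / k) :
    IsSidonSpace F
        (Submodule.span F {x : K | ∃ u ∈ Fk, x = u + u ^ q * γ}) ∧
      Module.finrank F
        ↥(Submodule.span F {x : K | ∃ u ∈ Fk, x = u + u ^ q * γ}) = k := by
  have hq0 : q ≠ 0 := hq.ne_zero
  have hq1 : 1 < q := hq.one_lt
  have : Finite F := Nat.finite_of_card_ne_zero (hF ▸ hq0)
  have : Finite K := Nat.finite_of_card_ne_zero (hK ▸ pow_ne_zero n hq0)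
  have hd : 2 < (minpoly Fk γ).natDegree := hdeg ▸ hdeg2
  obtain ⟨φ, hφ⟩ := exists_linearMap_add_pow_mul F γ
  rw [hF] at hφ
  let S : Submodule F K :=
    { Fk.toAddSubgroup with smul_mem' := fun c x hx => Fk.mul_mem (hFFk c.2) hx }
  have hspan : span F {x : K | ∃ u ∈ Fk, x = u + u ^ q * γ} = S.map φ := by
    rw [← span_eq (S.map φ)]
    congr 1
    ext x
    constructor
    · rintro ⟨u, hu, rfl⟩
      exact ⟨u, hu, hφ u⟩
    · rintro ⟨u, hu, rfl⟩
      exact ⟨u, hu, hφ u⟩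
  rw [hspan]
  constructor
  · rintro _ ⟨u, hu, rfl⟩ _ ⟨v, hv, rfl⟩ _ ⟨s, hs, rfl⟩ _ ⟨t, ht, rfl⟩ hu0 hv0 hs0 ht0 h
    have ne {w : K} (hw : φ w ≠ 0) : w ≠ 0 := fun h => hw (h ▸ map_zero φ)
    replace hu : u ∈ Fk := hu
    replace hv : v ∈ Fk := hv
    replace hs : s ∈ Fk := hs
    replace ht : t ∈ Fk := ht
    have hcoeff := eq_zero_of_quadratic_eq_zero Fk hd (a := u * v - s * t)
      (b := u * v ^ q + u ^ q * v - (s * t ^ q + s ^ q * t))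
      (c := u ^ q * v ^ q - s ^ q * t ^ q) (by aesop) (by aesop) (by aesop)
      (by simp only [hφ] at h; linear_combination h)
    have hmem {r : K} (hr : r ^ q = r) : r ∈ F := F.mem_of_pow_natCard_eq (hF.symm ▸ hr)
    have hlin {r x y : K} (hr : r ^ q = r) (hx : φ x ≠ 0) (h : x = r * y) :
        span F {φ x} = span F {φ y} := by
      refine span_singleton_eq_of_mul_mem F (hmem hr) ?_ ?_ (r := r)
      · rintro rfl
        exact ne hx (by simpa using h)
      · rw [hφ, hφ, h, mul_pow, hr]
        ring
    rcases exists_ratio_of_mul_eq (ne hv0) (ne hs0) (sub_eq_zero.1 hcoeff.1)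
      (sub_eq_zero.1 hcoeff.2.1) with ⟨r, hr, h1, h2⟩ | ⟨r, hr, h1, h2⟩
    · rw [hlin hr hu0 h1, hlin hr ht0 h2]
    · rw [hlin hr hu0 h1, hlin hr hs0 h2, Set.pair_comm]
  · have hinj : Function.Injective (φ.domRestrict S) := by
      rw [injective_iff_map_eq_zero]
      rintro ⟨u, hu⟩ h
      replace hu : u ∈ Fk := hu
      rw [LinearMap.domRestrict_apply, hφ] at h
      exact Subtype.ext (eq_zero_of_quadratic_eq_zero Fk hd hu (Fk.pow_mem hu q) Fk.zero_mem
        (by linear_combination h)).1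
    rw [← LinearMap.range_domRestrict, LinearMap.finrank_range_of_inj hinj]
    have hcard := Module.natCard_eq_pow_finrank (K := F) (V := S)
    rw [hF, show Nat.card S = q ^ k from hFk] at hcard
    exact (Nat.pow_right_injective hq1 hcard).symm
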